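/- arXiv:1206.4839 — 2 statements merged into one kernel-verified Lean document; each statement's English description precedes it below -/
import Mathlib

section
/- Let X and E be finite-dimensional real normed spaces with dim X = 2, f : S_X → S_E a bijective isometry, and F its positively homogeneous extension. Then F is Gateaux differentiable at every nonzero point of X. -/
open Filter Topology Metric Set MeasureTheory

noncomputable section

/-- The normalized direction `v / ‖v‖` of a vector (equal to `0` when `v = 0`). -/
def unitDir {X : Type*} [NormedAddCommGroup X] [NormedSpace ℝ X] (v : X) : X := ‖v‖⁻¹ • v

/-- The set `ℷ(x)` of support functionals at a point `x` of the unit sphere: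
functionals of norm one attaining the value `1` at `x`. -/
def suppFn (X : Type*) [NormedAddCommGroup X] [NormedSpace ℝ X] (x : X) :
    Set (X →L[ℝ] ℝ) := {g | ‖g‖ = 1 ∧ g x = 1}

/-- A point of the unit sphere is smooth if it has exactly one support functional. -/
def IsSmoothPt {X : Type*} [NormedAddCommGroup X] [NormedSpace ℝ X] (x : X) : Prop :=
  ∃ g : X →L[ℝ] ℝ, suppFn X x = {g}

/-- `D_y = {x ∈ S_X : ‖x + y‖ < 2}`. -/
def Dset {X : Type*} [NormedAddCommGroup X] [NormedSpace ℝ X] (y : X) : Set X :=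
  {x | x ∈ sphere (0 : X) 1 ∧ ‖x + y‖ < 2}

/-- `W_y`: points `x ∈ D_y` with `(x-y)/‖x-y‖` smooth in `X` and
`(f x - f y)/‖f x - f y‖` smooth in `E`. -/
def Wset {X E : Type*} [NormedAddCommGroup X] [NormedSpace ℝ X]
    [NormedAddCommGroup E] [NormedSpace ℝ E] (f : X → E) (y : X) : Set X :=
  {x | x ∈ Dset y ∧ IsSmoothPt (unitDir (x - y)) ∧ IsSmoothPt (unitDir (f x - f y))}

/-- `Λ_y`: the set of limit points of `(y - z)/‖y - z‖` as `z → y`, `z ∈ S_X`, `z ≠ y`. -/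
def tangentDirs {X : Type*} [NormedAddCommGroup X] [NormedSpace ℝ X] (y : X) : Set X :=
  {u | ∃ z : ℕ → X, (∀ n, z n ∈ sphere (0 : X) 1 ∧ z n ≠ y) ∧
    Tendsto z atTop (𝓝 y) ∧ Tendsto (fun n => unitDir (y - z n)) atTop (𝓝 u)}

/-- A linear map `T` represents the tangent action of `f` at `y`: whenever `y_n → y` on the
sphere with `(y - y_n)/‖y - y_n‖ → u`, one has `(f y - f y_n)/‖f y - f y_n‖ → T u`. -/
def RepTangent {X E : Type*} [NormedAddCommGroup X] [NormedSpace ℝ X]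
    [NormedAddCommGroup E] [NormedSpace ℝ E] (f : X → E) (y : X) (T : X →ₗ[ℝ] E) : Prop :=
  ∀ (z : ℕ → X) (u : X), (∀ n, z n ∈ sphere (0 : X) 1 ∧ z n ≠ y) →
    Tendsto z atTop (𝓝 y) → Tendsto (fun n => unitDir (y - z n)) atTop (𝓝 u) →
    Tendsto (fun n => unitDir (f y - f (z n))) atTop (𝓝 (T u))

/-- The positively homogeneous extension `F` of `f`: `F 0 = 0`, `F x = ‖x‖ • f (x/‖x‖)`. -/
def homExt {X E : Type*} [NormedAddCommGroup X] [NormedSpace ℝ X]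
    [NormedAddCommGroup E] [NormedSpace ℝ E] (f : X → E) (x : X) : E :=
  ‖x‖ • f (unitDir x)

/-- `F` is Gateaux differentiable at `y`: all one-sided directional derivatives exist and
depend linearly (and continuously) on the direction. -/
def GateauxAt {X E : Type*} [NormedAddCommGroup X] [NormedSpace ℝ X]
    [NormedAddCommGroup E] [NormedSpace ℝ E] (F : X → E) (y : X) : Prop :=
  ∃ L : X →L[ℝ] E, ∀ z : X,
    Tendsto (fun a : ℝ => a⁻¹ • (F (y + a • z) - F y)) (𝓝[>] 0) (𝓝 (L z))

section NormDirDeriv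

variable {V : Type*} [NormedAddCommGroup V] [NormedSpace ℝ V]

/-- The one-sided directional derivative at `w` of the norm, in the direction `z`. -/
def normDirDeriv (w z : V) : ℝ := sInf ((fun a : ℝ => (‖w + a • z‖ - ‖w‖) / a) '' Ioi 0)

lemma neg_norm_le_norm_slope (w z : V) {a : ℝ} (ha : 0 < a) :
    -‖z‖ ≤ (‖w + a • z‖ - ‖w‖) / a := by
  rw [le_div_iff₀ ha]
  have h := norm_sub_le (w + a • z) (a • z)
  rw [add_sub_cancel_right, norm_smul, Real.norm_of_nonneg ha.le] at h
  linarith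

lemma norm_slope_monotoneOn (w z : V) :
    MonotoneOn (fun a : ℝ => (‖w + a • z‖ - ‖w‖) / a) (Ioi 0) := by
  intro a ha b hb hab
  have ha' : (0 : ℝ) < a := ha
  have hb' : (0 : ℝ) < b := hb
  have key : w + a • z = (1 - a / b) • w + (a / b) • (w + b • z) := by
    rw [smul_add, smul_smul, div_mul_cancel₀ _ hb'.ne']
    module
  have h1 : ‖w + a • z‖ ≤ (1 - a / b) * ‖w‖ + (a / b) * ‖w + b • z‖ := by
    rw [key]
    refine (norm_add_le _ _).trans ?_
    rw [norm_smul, norm_smul, Real.norm_of_nonneg (by rw [sub_nonneg, div_le_one hb']; exact hab),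
      Real.norm_of_nonneg (by positivity)]
  have h2 : (‖w + a • z‖ - ‖w‖) ≤ (a / b) * (‖w + b • z‖ - ‖w‖) := by linarith
  change (‖w + a • z‖ - ‖w‖) / a ≤ (‖w + b • z‖ - ‖w‖) / b
  rw [div_le_iff₀ ha']
  calc _ ≤ _ := h2
    _ = _ := by field_simp

lemma bddBelow_norm_slope (w z : V) :
    BddBelow ((fun a : ℝ => (‖w + a • z‖ - ‖w‖) / a) '' Ioi 0) := by
  refine ⟨-‖z‖, ?_⟩
  rintro _ ⟨a, ha, rfl⟩
  exact neg_norm_le_norm_slope w z ha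

lemma tendsto_normDirDeriv (w z : V) :
    Tendsto (fun a : ℝ => (‖w + a • z‖ - ‖w‖) / a) (𝓝[>] 0) (𝓝 (normDirDeriv w z)) :=
  (norm_slope_monotoneOn w z).tendsto_nhdsGT (bddBelow_norm_slope w z)

lemma normDirDeriv_le_slope (w z : V) {a : ℝ} (ha : 0 < a) :
    normDirDeriv w z ≤ (‖w + a • z‖ - ‖w‖) / a :=
  csInf_le (bddBelow_norm_slope w z) ⟨a, ha, rfl⟩

lemma normDirDeriv_le_sub (w z : V) : normDirDeriv w z ≤ ‖w + z‖ - ‖w‖ := by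
  simpa using normDirDeriv_le_slope w z one_pos

lemma normDirDeriv_le_norm (w z : V) : normDirDeriv w z ≤ ‖z‖ := by
  linarith [normDirDeriv_le_sub w z, norm_add_le w z]

lemma neg_norm_le_normDirDeriv (w z : V) : -‖z‖ ≤ normDirDeriv w z := by
  refine le_csInf ⟨_, 1, mem_Ioi.2 one_pos, rfl⟩ ?_
  rintro _ ⟨a, ha, rfl⟩
  exact neg_norm_le_norm_slope w z ha

lemma eventually_pos : ∀ᶠ a : ℝ in 𝓝[>] 0, 0 < a := self_mem_nhdsWithin

lemma tendsto_mul_nhdsGT {c : ℝ} (hc : 0 < c) :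
    Tendsto (fun a : ℝ => c * a) (𝓝[>] 0) (𝓝[>] 0) := by
  refine tendsto_nhdsWithin_iff.2 ⟨?_, ?_⟩
  · have : Tendsto (fun a : ℝ => c * a) (𝓝 0) (𝓝 (c * 0)) := (continuous_const_mul c).tendsto 0
    rw [mul_zero] at this
    exact this.mono_left nhdsWithin_le_nhds
  · filter_upwards [eventually_pos] with a ha using mul_pos hc ha

/-- The norm expands to first order along any curve with a one-sided velocity. -/
lemma tendsto_norm_slope_of_tendsto (w z : V) {l : Filter ℝ} (hl : l ≤ 𝓝[>] 0) {r : ℝ → V}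
    (hr : Tendsto r l (𝓝 z)) :
    Tendsto (fun a : ℝ => (‖w + a • r a‖ - ‖w‖) / a) l (𝓝 (normDirDeriv w z)) := by
  have h0 : Tendsto (fun a => ‖r a - z‖) l (𝓝 0) := by
    simpa using (hr.sub_const z).norm
  have h1 : Tendsto (fun a => (‖w + a • r a‖ - ‖w‖) / a - (‖w + a • z‖ - ‖w‖) / a) l (𝓝 0) := by
    refine squeeze_zero_norm' ?_ h0
    filter_upwards [hl eventually_pos] with a ha
    rw [← sub_div, Real.norm_eq_abs, abs_div, abs_of_pos ha, div_le_iff₀ ha]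
    have := abs_norm_sub_norm_le (w + a • r a) (w + a • z)
    rw [add_sub_add_left_eq_sub, ← smul_sub, norm_smul, Real.norm_of_nonneg ha.le] at this
    rw [sub_sub_sub_cancel_right]
    linarith
  simpa using h1.add ((tendsto_normDirDeriv w z).mono_left hl)

lemma normDirDeriv_eq_of_tendsto {w z : V} {L : ℝ}
    (h : Tendsto (fun a : ℝ => (‖w + a • z‖ - ‖w‖) / a) (𝓝[>] 0) (𝓝 L)) :
    normDirDeriv w z = L :=
  tendsto_nhds_unique (tendsto_normDirDeriv w z) h

lemma normDirDeriv_zero_right (w : V) : normDirDeriv w 0 = 0 :=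
  normDirDeriv_eq_of_tendsto (by simp)

lemma normDirDeriv_smul_right (w z : V) {c : ℝ} (hc : 0 ≤ c) :
    normDirDeriv w (c • z) = c * normDirDeriv w z := by
  rcases hc.eq_or_lt with rfl | hc
  · simp [normDirDeriv_zero_right]
  refine normDirDeriv_eq_of_tendsto ?_
  refine (((tendsto_normDirDeriv w z).comp (tendsto_mul_nhdsGT hc)).const_mul c).congr' ?_
  filter_upwards [eventually_pos] with a ha
  simp only [Function.comp, smul_smul, mul_comm c a]
  field_simp

lemma normDirDeriv_smul_left (w z : V) {c : ℝ} (hc : 0 < c) :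
    normDirDeriv (c • w) z = normDirDeriv w z := by
  refine normDirDeriv_eq_of_tendsto ?_
  refine ((tendsto_normDirDeriv w z).comp (tendsto_mul_nhdsGT (inv_pos.2 hc))).congr' ?_
  filter_upwards [eventually_pos] with a ha
  have : c • w + a • z = c • (w + (c⁻¹ * a) • z) := by
    rw [smul_add, smul_smul, mul_inv_cancel_left₀ hc.ne']
  simp only [Function.comp]
  rw [this, norm_smul, norm_smul, Real.norm_of_nonneg hc.le]
  field_simp

lemma normDirDeriv_add_le (w z z' : V) :
    normDirDeriv w (z + z') ≤ normDirDeriv w z + normDirDeriv w z' := by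
  have h1 := (tendsto_normDirDeriv w z).comp (tendsto_mul_nhdsGT two_pos)
  have h2 := (tendsto_normDirDeriv w z').comp (tendsto_mul_nhdsGT two_pos)
  refine le_of_tendsto_of_tendsto (tendsto_normDirDeriv w (z + z')) (h1.add h2) ?_
  filter_upwards [eventually_pos] with a ha
  simp only [Function.comp]
  rw [← add_div, div_le_div_iff₀ ha (by positivity)]
  have h3 : (2 : ℝ) • (w + a • (z + z')) = (w + (2 * a) • z) + (w + (2 * a) • z') := by module
  have h4 := norm_add_le (w + (2 * a) • z) (w + (2 * a) • z')
  rw [← h3, norm_smul, Real.norm_of_nonneg zero_le_two] at h4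
  nlinarith

lemma normDirDeriv_add_neg_nonneg (w z : V) :
    0 ≤ normDirDeriv w z + normDirDeriv w (-z) := by
  simpa [normDirDeriv_zero_right] using normDirDeriv_add_le w z (-z)

lemma normDirDeriv_self (w : V) : normDirDeriv w w = ‖w‖ := by
  refine le_antisymm (normDirDeriv_le_norm w w) ?_
  refine le_csInf ⟨_, 1, mem_Ioi.2 one_pos, rfl⟩ ?_
  rintro _ ⟨a, ha, rfl⟩
  have ha' : (0 : ℝ) < a := ha
  have : w + a • w = (1 + a) • w := by module
  simp only [this]
  rw [norm_smul, Real.norm_of_nonneg (by linarith), le_div_iff₀ ha']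
  linarith

lemma normDirDeriv_neg_self (w : V) : normDirDeriv w (-w) = -‖w‖ := by
  refine le_antisymm ?_ (by simpa using neg_norm_le_normDirDeriv w (-w))
  simpa using normDirDeriv_le_sub w (-w)

lemma normDirDeriv_smul_self (w : V) (t : ℝ) : normDirDeriv w (t • w) = t * ‖w‖ := by
  rcases le_total 0 t with ht | ht
  · rw [normDirDeriv_smul_right w w ht, normDirDeriv_self]
  · have : t • w = (-t) • (-w) := by module
    rw [this, normDirDeriv_smul_right w _ (by linarith), normDirDeriv_neg_self]
    ring

lemma normDirDeriv_add_smul_self (w z : V) (t : ℝ) :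
    normDirDeriv w (z + t • w) = normDirDeriv w z + t * ‖w‖ := by
  refine le_antisymm ?_ ?_
  · simpa [normDirDeriv_smul_self] using normDirDeriv_add_le w z (t • w)
  · have h := normDirDeriv_add_le w (z + t • w) ((-t) • w)
    have e : z + t • w + (-t) • w = z := by module
    rw [e, normDirDeriv_smul_self] at h
    linarith

lemma normDirDeriv_neg_left (w z : V) : normDirDeriv (-w) z = normDirDeriv w (-z) := by
  refine normDirDeriv_eq_of_tendsto ((tendsto_normDirDeriv w (-z)).congr fun a => ?_)
  have : -w + a • z = -(w + a • (-z)) := by module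
  rw [this, norm_neg, norm_neg]

/-- At a point of differentiability of the norm, the directional derivative is linear. -/
lemma exists_clm_normDirDeriv_eq {w : V} (h : DifferentiableAt ℝ (fun x : V => ‖x‖) w) :
    ∃ g : V →L[ℝ] ℝ, ∀ z, normDirDeriv w z = g z := by
  refine ⟨fderiv ℝ (fun x : V => ‖x‖) w, fun z => normDirDeriv_eq_of_tendsto ?_⟩
  have h1 := (h.hasFDerivAt.hasLineDerivAt z).hasDerivWithinAt (s := Ioi 0)
  rw [hasDerivWithinAt_iff_tendsto_slope' (by simp)] at h1
  refine h1.congr fun a => ?_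
  simp [slope_def_field]

lemma normDirDeriv_map {W : Type*} [NormedAddCommGroup W] [NormedSpace ℝ W] (T : V →L[ℝ] W)
    (hT : ∀ z, ‖T z‖ = ‖z‖) (w z : V) : normDirDeriv (T w) (T z) = normDirDeriv w z := by
  refine normDirDeriv_eq_of_tendsto ((tendsto_normDirDeriv w z).congr fun a => ?_)
  rw [← hT (w + a • z), ← hT w, map_add, map_smul]

end NormDirDeriv

section Plane

variable {V : Type*} [NormedAddCommGroup V] [NormedSpace ℝ V]

/-- Coordinate functionals of a pair of independent vectors of a plane. -/
lemma exists_coord_of_finrank_two [FiniteDimensional ℝ V] (hdim : Module.finrank ℝ V = 2)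
    {x₁ x₂ : V} (h : ∀ α β : ℝ, α • x₁ + β • x₂ = 0 → α = 0 ∧ β = 0) :
    ∃ c₁ c₂ : V →L[ℝ] ℝ, (∀ z, z = c₁ z • x₁ + c₂ z • x₂) ∧
      c₁ x₁ = 1 ∧ c₁ x₂ = 0 ∧ c₂ x₁ = 0 ∧ c₂ x₂ = 1 := by
  have hli : LinearIndependent ℝ ![x₁, x₂] := LinearIndependent.pair_iff.2 h
  let b := basisOfLinearIndependentOfCardEqFinrank hli (by simp [hdim])
  have hb : ∀ i, b i = ![x₁, x₂] i := fun i => by simp [b]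
  have h0 : b 0 = x₁ := by simp [hb]
  have h1 : b 1 = x₂ := by simp [hb]
  refine ⟨(b.coord 0).toContinuousLinearMap, (b.coord 1).toContinuousLinearMap, fun z => ?_, ?_⟩
  · have := b.sum_repr z
    rw [Fin.sum_univ_two, h0, h1] at this
    exact this.symm
  · simp only [LinearMap.coe_toContinuousLinearMap', ← h0, ← h1]
    simp

/-- `k₁, k₂` are the unit vectors spanning the two half-tangents of the unit sphere at `s`. -/
structure IsTangentPair (s k₁ k₂ : V) : Prop where
  norm_base : ‖s‖ = 1
  norm_left : ‖k₁‖ = 1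
  norm_right : ‖k₂‖ = 1
  deriv_left : normDirDeriv s k₁ = 0
  deriv_right : normDirDeriv s k₂ = 0
  cover : ∀ z, ∃ c t : ℝ, 0 ≤ c ∧ (z = c • k₁ + t • s ∨ z = c • k₂ + t • s)

namespace IsTangentPair

variable {s k₁ k₂ : V}

lemma symm (h : IsTangentPair s k₁ k₂) : IsTangentPair s k₂ k₁ where
  norm_base := h.norm_base
  norm_left := h.norm_right
  norm_right := h.norm_left
  deriv_left := h.deriv_right
  deriv_right := h.deriv_left
  cover z := by
    obtain ⟨c, t, hc, hz⟩ := h.cover z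
    exact ⟨c, t, hc, hz.symm⟩

lemma deriv_comb (h : IsTangentPair s k₁ k₂) {c : ℝ} (hc : 0 ≤ c) (t : ℝ) :
    normDirDeriv s (c • k₁ + t • s) = t := by
  rw [normDirDeriv_add_smul_self, normDirDeriv_smul_right _ _ hc, h.deriv_left, h.norm_base]
  ring

lemma indep_base (h : IsTangentPair s k₁ k₂) (ν τ : ℝ) (h0 : ν • k₁ + τ • s = 0) :
    ν = 0 ∧ τ = 0 := by
  have hs : s ≠ 0 := by
    rw [← norm_ne_zero_iff, h.norm_base]; exact one_ne_zero
  have hν : ν = 0 := by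
    by_contra hν
    have hk : k₁ = (-(ν⁻¹ * τ)) • s := by
      have := congrArg (fun x => ν⁻¹ • x) h0
      simp only [smul_add, smul_smul, inv_mul_cancel₀ hν, one_smul, smul_zero] at this
      rw [neg_smul]
      exact eq_neg_of_add_eq_zero_left this
    have hd := h.deriv_left
    rw [hk, normDirDeriv_smul_self, h.norm_base, mul_one] at hd
    have := h.norm_left
    rw [hk, hd] at this
    simp at this
  subst hν
  simpa [hs] using h0

/-- The two half-tangents are either opposite, or enclose a proper cone containing `-s`. -/
lemma exists_relation (h : IsTangentPair s k₁ k₂) :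
    ∃ c t : ℝ, 0 < c ∧ 0 ≤ t ∧ k₁ + c • k₂ = (-t) • s := by
  obtain ⟨c, t, hc, hz | hz⟩ := h.cover (-k₁)
  · have h0 : (1 + c) • k₁ + t • s = 0 := by
      have : (1 + c) • k₁ + t • s = k₁ + (c • k₁ + t • s) := by module
      rw [this, ← hz, add_neg_cancel]
    have := (h.indep_base _ _ h0).1
    linarith
  · have ht : normDirDeriv s (-k₁) = t := by rw [hz]; exact h.symm.deriv_comb hc t
    refine ⟨c, t, hc.lt_of_ne' ?_, ?_, ?_⟩
    · rintro rfl
      have h0 : (1 : ℝ) • k₁ + t • s = 0 := by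
        have : (1 : ℝ) • k₁ + t • s = k₁ + ((0 : ℝ) • k₂ + t • s) := by module
        rw [this, ← hz, add_neg_cancel]
      exact one_ne_zero (h.indep_base _ _ h0).1
    · have := normDirDeriv_add_neg_nonneg s k₁
      rwa [h.deriv_left, zero_add, ht] at this
    · have : k₁ + c • k₂ = (k₁ + (c • k₂ + t • s)) + (-t) • s := by module
      rw [this, ← hz, add_neg_cancel, zero_add]

lemma ne (h : IsTangentPair s k₁ k₂) : k₁ ≠ k₂ := by
  obtain ⟨c, t, hc, -, hr⟩ := h.exists_relation
  rintro rfl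
  have h0 : (1 + c) • k₁ + t • s = 0 := by
    have : (1 + c) • k₁ + t • s = (k₁ + c • k₁) + t • s := by module
    rw [this, hr]; module
  have := (h.indep_base _ _ h0).1
  linarith

lemma eq_or_eq (h : IsTangentPair s k₁ k₂) {k : V} (hk : ‖k‖ = 1) (hd : normDirDeriv s k = 0) :
    k = k₁ ∨ k = k₂ := by
  obtain ⟨c, t, hc, hz | hz⟩ := h.cover k
  · left
    rw [hz, h.deriv_comb hc] at hd
    subst hd
    rw [hz, zero_smul, add_zero, norm_smul, h.norm_left, Real.norm_of_nonneg hc, mul_one] at hk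
    rw [hz, hk]; simp
  · right
    rw [hz, h.symm.deriv_comb hc] at hd
    subst hd
    rw [hz, zero_smul, add_zero, norm_smul, h.norm_right, Real.norm_of_nonneg hc, mul_one] at hk
    rw [hz, hk]; simp

/-- At a corner, the two half-tangents are linearly independent. -/
lemma indep_of_relation (h : IsTangentPair s k₁ k₂) {c t : ℝ} (hc : 0 < c) (ht : 0 < t)
    (hr : k₁ + c • k₂ = (-t) • s) (α β : ℝ) (h0 : α • k₁ + β • k₂ = 0) : α = 0 ∧ β = 0 := by
  have h1 : (c * α - β) • k₁ + (-(β * t)) • s = 0 := by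
    have : (c * α - β) • k₁ + (-(β * t)) • s
      = c • (α • k₁ + β • k₂) - β • ((k₁ + c • k₂) - (-t) • s) := by module
    rw [this, h0, hr]; simp
  obtain ⟨h2, h3⟩ := h.indep_base _ _ h1
  have hβ : β = 0 := by
    rcases mul_eq_zero.1 (neg_eq_zero.1 h3) with h | h
    · exact h
    · exact absurd h ht.ne'
  subst hβ
  have : c * α = 0 := by linarith
  exact ⟨(mul_eq_zero.1 this).resolve_left hc.ne', rfl⟩

lemma deriv_cone_nonpos (h : IsTangentPair s k₁ k₂) {α β : ℝ} (hα : 0 ≤ α) (hβ : 0 ≤ β) :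
    normDirDeriv s (α • k₁ + β • k₂) ≤ 0 := by
  refine (normDirDeriv_add_le _ _ _).trans ?_
  rw [normDirDeriv_smul_right _ _ hα, normDirDeriv_smul_right _ _ hβ, h.deriv_left, h.deriv_right]
  simp

/-- Interior directions of the tangent cone at a corner point strictly into the ball. -/
lemma deriv_cone_neg (h : IsTangentPair s k₁ k₂) {c t : ℝ} (hc : 0 < c) (ht : 0 < t)
    (hr : k₁ + c • k₂ = (-t) • s) {α β : ℝ} (hα : 0 < α) (hβ : 0 < β) :
    normDirDeriv s (α • k₁ + β • k₂) < 0 := by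
  set m := min α (β / c) with hm
  have hm0 : 0 < m := lt_min hα (by positivity)
  have h1 : m ≤ α := min_le_left _ _
  have h2 : m * c ≤ β := by
    have : m ≤ β / c := min_le_right _ _
    rwa [le_div_iff₀ hc] at this
  have key : α • k₁ + β • k₂ = ((α - m) • k₁ + (β - m * c) • k₂) + (-(m * t)) • s := by
    have : α • k₁ + β • k₂ = ((α - m) • k₁ + (β - m * c) • k₂) + m • (k₁ + c • k₂) := by module
    rw [this, hr]; module
  rw [key, normDirDeriv_add_smul_self, h.norm_base]
  have := h.deriv_cone_nonpos (sub_nonneg.2 h1) (sub_nonneg.2 h2)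
  have := mul_pos hm0 ht
  linarith

end IsTangentPair

lemma exists_isTangentPair (hdim : Module.finrank ℝ V = 2) [FiniteDimensional ℝ V] {s : V}
    (hs : ‖s‖ = 1) : ∃ k₁ k₂ : V, IsTangentPair s k₁ k₂ := by
  have hs0 : s ≠ 0 := by
    rw [← norm_ne_zero_iff, hs]; exact one_ne_zero
  obtain ⟨e, he⟩ := exists_linearIndependent_pair_of_one_lt_finrank
    (R := ℝ) (by rw [hdim]; norm_num) hs0
  rw [LinearIndependent.pair_iff] at he
  obtain ⟨c₁, c₂, hc, -⟩ := exists_coord_of_finrank_two hdim he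
  set u := e - normDirDeriv s e • s with hu
  set v := -e - normDirDeriv s (-e) • s with hv
  have hu0 : u ≠ 0 := fun h => by
    have := (he (-normDirDeriv s e) 1 (by rw [← h, hu]; module)).2
    exact one_ne_zero this
  have hv0 : v ≠ 0 := fun h => by
    have := (he (-normDirDeriv s (-e)) (-1) (by rw [← h, hv]; module)).2
    norm_num at this
  have hun := norm_pos_iff.2 hu0
  have hvn := norm_pos_iff.2 hv0
  have hdu : normDirDeriv s u = 0 := by
    rw [hu, sub_eq_add_neg, ← neg_smul, normDirDeriv_add_smul_self, hs]; ring
  have hdv : normDirDeriv s v = 0 := by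
    rw [hv, sub_eq_add_neg, ← neg_smul, normDirDeriv_add_smul_self, hs]; ring
  refine ⟨‖u‖⁻¹ • u, ‖v‖⁻¹ • v, hs, norm_smul_inv_norm hu0, norm_smul_inv_norm hv0, ?_, ?_, ?_⟩
  · rw [normDirDeriv_smul_right _ _ (by positivity), hdu, mul_zero]
  · rw [normDirDeriv_smul_right _ _ (by positivity), hdv, mul_zero]
  · intro z
    rcases le_total 0 (c₂ z) with h | h
    · refine ⟨c₂ z * ‖u‖, c₁ z + c₂ z * normDirDeriv s e, by positivity, Or.inl ?_⟩
      rw [smul_smul, mul_assoc, mul_inv_cancel₀ hun.ne', hu]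
      nth_rewrite 1 [hc z]
      module
    · refine ⟨-c₂ z * ‖v‖, c₁ z - c₂ z * normDirDeriv s (-e),
        mul_nonneg (by linarith) hvn.le, Or.inr ?_⟩
      rw [smul_smul, mul_assoc, mul_inv_cancel₀ hvn.ne', hv]
      nth_rewrite 1 [hc z]
      module

/-- A direction pointing strictly into the unit ball meets the sphere again. -/
lemma exists_norm_add_smul_eq_one {s d : V} (hs : ‖s‖ = 1) (hd : normDirDeriv s d < 0) :
    ∃ a : ℝ, 0 < a ∧ ‖s + a • d‖ = 1 := by
  have hd0 : 0 < ‖d‖ := by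
    linarith [neg_norm_le_normDirDeriv s d]
  obtain ⟨a₀, h1, h2⟩ := (((tendsto_normDirDeriv s d).eventually_lt_const hd).and
    eventually_pos).exists
  have h3 : ‖s + a₀ • d‖ < 1 := by
    rw [div_neg_iff] at h1
    rcases h1 with h | h <;> linarith
  set b := a₀ + 2 / ‖d‖ with hb
  have h4 : 1 ≤ ‖s + b • d‖ := by
    have h := norm_sub_le (s + b • d) s
    rw [add_sub_cancel_left, norm_smul, hs, Real.norm_of_nonneg (by positivity), hb, add_mul,
      div_mul_cancel₀ _ hd0.ne'] at h
    nlinarith [mul_pos h2 hd0]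
  have hab : a₀ ≤ b := by
    have : 0 < 2 / ‖d‖ := by positivity
    linarith
  have hcont : ContinuousOn (fun a : ℝ => ‖s + a • d‖) (Icc a₀ b) := by fun_prop
  obtain ⟨a, ha, ha1⟩ := intermediate_value_Icc hab hcont ⟨h3.le, h4⟩
  exact ⟨a, h2.trans_le ha.1, ha1⟩

/-- If the directional derivatives of the norm along `-v₁, -v₂`, at every point of the open cone
spanned by `v₁, v₂`, are matched by those along `-u₁, -u₂` somewhere in `U`, then the norm on the
cone of the `vᵢ` is dominated by the norm on the cone of the `uᵢ`. -/
lemma norm_comb_le_of_normDirDeriv_eq {U : Type*} [NormedAddCommGroup U] [NormedSpace ℝ U]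
    [FiniteDimensional ℝ V] (hdim : Module.finrank ℝ V = 2) {v₁ v₂ : V} {u₁ u₂ : U}
    (hv : ∀ α β : ℝ, α • v₁ + β • v₂ = 0 → α = 0 ∧ β = 0)
    (H : ∀ α β : ℝ, 0 < α → 0 < β → ∃ w : U,
      normDirDeriv w (-u₁) = normDirDeriv (α • v₁ + β • v₂) (-v₁) ∧
      normDirDeriv w (-u₂) = normDirDeriv (α • v₁ + β • v₂) (-v₂))
    {α β : ℝ} (hα : 0 < α) (hβ : 0 < β) : ‖α • v₁ + β • v₂‖ ≤ ‖α • u₁ + β • u₂‖ := by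
  obtain ⟨c₁, c₂, hc, h11, h12, h21, h22⟩ := exists_coord_of_finrank_two hdim hv
  let S : Set V := {d | 0 < c₁ d ∧ 0 < c₂ d}
  let C : Set V := {d | ‖d‖ ≤ ‖c₁ d • u₁ + c₂ d • u₂‖}
  have hS : IsOpen S :=
    (isOpen_lt continuous_const c₁.continuous).inter (isOpen_lt continuous_const c₂.continuous)
  have hC : IsClosed C := isClosed_le (by fun_prop) (by fun_prop)
  have hsub : S ⊆ C := by
    refine ((dense_differentiableAt_norm (E := V)).open_subset_closure_inter hS).trans
      (closure_minimal ?_ hC)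
    rintro d ⟨⟨hd1, hd2⟩, hdiff⟩
    obtain ⟨g, hg⟩ := exists_clm_normDirDeriv_eq hdiff
    obtain ⟨w, hw1, hw2⟩ := H _ _ hd1 hd2
    rw [← hc d, hg] at hw1 hw2
    have h1 : normDirDeriv w (c₁ d • (-u₁) + c₂ d • (-u₂)) ≤ g (-d) := by
      refine (normDirDeriv_add_le _ _ _).trans (le_of_eq ?_)
      rw [normDirDeriv_smul_right _ _ hd1.le, normDirDeriv_smul_right _ _ hd2.le, hw1, hw2]
      nth_rewrite 3 [hc d]
      simp only [map_neg, map_add, map_smul, smul_eq_mul]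
      ring
    have h2 := neg_norm_le_normDirDeriv w (c₁ d • (-u₁) + c₂ d • (-u₂))
    have h3 : c₁ d • (-u₁) + c₂ d • (-u₂) = -(c₁ d • u₁ + c₂ d • u₂) := by module
    rw [h3, norm_neg] at h2
    rw [h3, ← hg, normDirDeriv_neg_self] at h1
    change ‖d‖ ≤ _
    linarith
  have e1 : c₁ (α • v₁ + β • v₂) = α := by simp [h11, h12]
  have e2 : c₂ (α • v₁ + β • v₂) = β := by simp [h21, h22]
  have := hsub (show α • v₁ + β • v₂ ∈ S from ⟨by rwa [e1], by rwa [e2]⟩)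
  simpa only [C, mem_ofPred_eq, e1, e2] using this

/-- A corner `y` of the sphere is determined by the derivatives of the norm along `-u`, for points
lying on one given side of `y`. -/
lemma eq_of_normDirDeriv_eq {y w u : V} (hy : ‖y‖ = 1) (hw : ‖w‖ = 1) (hu : ‖u‖ = 1) {l m : ℝ}
    (hl : 0 ≤ l) (hm : 0 ≤ m) (hwe : w = l • u + m • y)
    (hd : normDirDeriv w (-u) = normDirDeriv y (-u))
    (hpos : 0 < normDirDeriv y u + normDirDeriv y (-u)) : w = y := by
  have h1 : l * normDirDeriv w (-u) ≤ m - 1 := by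
    rw [← normDirDeriv_smul_right _ _ hl]
    refine (normDirDeriv_le_sub _ _).trans (le_of_eq ?_)
    have : w + l • (-u) = m • y := by rw [hwe]; module
    rw [this, norm_smul, hy, hw, Real.norm_of_nonneg hm, mul_one]
  have h2 : l * normDirDeriv y u ≤ 1 - m := by
    rcases hm.eq_or_lt with rfl | hm
    · have hl1 : l = 1 := by
        rw [hwe, zero_smul, add_zero, norm_smul, hu, Real.norm_of_nonneg hl, mul_one] at hw
        exact hw
      have := normDirDeriv_le_norm y u
      rw [hu] at this
      rw [hl1]; linarith
    · have h := normDirDeriv_le_slope y u (a := l / m)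
      rcases hl.eq_or_lt with rfl | hl
      · rw [zero_smul, zero_add] at hwe
        rw [hwe, norm_smul, hy, Real.norm_of_nonneg hm.le, mul_one] at hw
        rw [hw]; simp
      have h := h (by positivity)
      have e : y + (l / m) • u = m⁻¹ • w := by
        rw [hwe, smul_add, smul_smul, smul_smul, inv_mul_cancel₀ hm.ne']
        module
      rw [e, norm_smul, hw, hy, Real.norm_of_nonneg (by positivity), le_div_iff₀ (by positivity)] at h
      have := mul_le_mul_of_nonneg_left h hm.le
      field_simp at this
      linarith
  have hl0 : l = 0 := by
    by_contra hne
    have hlp : 0 < l := hl.lt_of_ne' hne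
    have := mul_pos hlp hpos
    rw [hd] at h1
    linarith
  subst hl0
  rw [zero_smul, zero_add] at hwe
  rw [hwe, norm_smul, hy, Real.norm_of_nonneg hm, mul_one] at hw
  rw [hwe, hw, one_smul]

end Plane

section SphereIsometry

variable {X E : Type*} [NormedAddCommGroup X] [NormedSpace ℝ X]
  [NormedAddCommGroup E] [NormedSpace ℝ E]

lemma norm_unitDir {v : X} (hv : v ≠ 0) : ‖unitDir v‖ = 1 := norm_smul_inv_norm hv

lemma norm_smul_unitDir (v : X) : ‖v‖ • unitDir v = v := by
  rcases eq_or_ne v 0 with rfl | hv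
  · simp
  · rw [unitDir, smul_inv_smul₀ (norm_ne_zero_iff.2 hv)]

lemma unitDir_of_norm_eq_one {v : X} (hv : ‖v‖ = 1) : unitDir v = v := by
  simp [unitDir, hv]

lemma unitDir_smul {c : ℝ} (hc : 0 < c) (v : X) : unitDir (c • v) = unitDir v := by
  rw [unitDir, unitDir, norm_smul, Real.norm_of_nonneg hc.le, smul_smul, mul_inv]
  congr 1
  field_simp

lemma tendsto_add_smul (y z : X) :
    Tendsto (fun a : ℝ => y + a • z) (𝓝[>] 0) (𝓝 y) := by
  have h : Continuous fun a : ℝ => y + a • z := by fun_prop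
  simpa using (h.tendsto 0).mono_left nhdsWithin_le_nhds

lemma eventually_add_smul_ne_zero {y : X} (hy : ‖y‖ = 1) (z : X) :
    ∀ᶠ a : ℝ in 𝓝[>] 0, y + a • z ≠ 0 := by
  refine (tendsto_add_smul y z).eventually_ne ?_
  rw [← norm_ne_zero_iff, hy]
  exact one_ne_zero

/-- The one-sided velocity of the radial projection to the sphere. -/
lemma tendsto_unitDir_slope {y : X} (hy : ‖y‖ = 1) (z : X) :
    Tendsto (fun a : ℝ => a⁻¹ • (unitDir (y + a • z) - y)) (𝓝[>] 0)
      (𝓝 (z - normDirDeriv y z • y)) := by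
  have h1 : Tendsto (fun a : ℝ => ‖y + a • z‖⁻¹) (𝓝[>] 0) (𝓝 1) := by
    simpa [hy] using (tendsto_add_smul y z).norm.inv₀ (by rw [hy]; exact one_ne_zero)
  have h2 := h1.smul (((tendsto_normDirDeriv y z).smul_const y).const_sub z)
  rw [one_smul] at h2
  refine h2.congr' ?_
  filter_upwards [eventually_pos, eventually_add_smul_ne_zero hy z] with a ha h0
  have hN := norm_ne_zero_iff.2 h0
  rw [unitDir, hy]
  set N := ‖y + a • z‖ with hNdef
  have hy1 : y = N⁻¹ • N • y := by rw [smul_smul, inv_mul_cancel₀ hN, one_smul]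
  nth_rewrite 3 [hy1]
  rw [← smul_sub, smul_comm a⁻¹]
  congr 1
  have : y + a • z - N • y = a • (z - ((N - 1) / a) • y) := by
    rw [smul_sub, smul_smul, mul_div_cancel₀ _ ha.ne']
    module
  rw [this, smul_smul, inv_mul_cancel₀ ha.ne', one_smul]

/-- `f` has one-sided derivative `v` at `y` along the projection to the sphere of the ray from `y`
in the direction `z`. -/
def HasSphereDeriv (f : X → E) (y z : X) (v : E) : Prop :=
  Tendsto (fun a : ℝ => a⁻¹ • (f (unitDir (y + a • z)) - f y)) (𝓝[>] 0) (𝓝 v)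

lemma HasSphereDeriv.smul {f : X → E} {y z : X} {v : E} (hy : ‖y‖ = 1)
    (h : HasSphereDeriv f y z v) {c : ℝ} (hc : 0 ≤ c) : HasSphereDeriv f y (c • z) (c • v) := by
  rcases hc.eq_or_lt with rfl | hc
  · simp [HasSphereDeriv, unitDir_of_norm_eq_one hy]
  · refine ((Tendsto.comp h (tendsto_mul_nhdsGT hc)).const_smul c).congr' ?_
    filter_upwards [eventually_pos] with a ha
    simp only [Function.comp, smul_smul, mul_comm c a]
    congr 1
    field_simp

variable {f : X → E} (hmaps : ∀ x ∈ sphere (0 : X) 1, ‖f x‖ = 1)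
  (hiso : ∀ x ∈ sphere (0 : X) 1, ∀ x' ∈ sphere (0 : X) 1, ‖f x - f x'‖ = ‖x - x'‖)

include hiso in
lemma tendsto_norm_sphere_slope_sub {y : X} (hy : ‖y‖ = 1) (z z' : X) :
    Tendsto (fun a : ℝ => ‖a⁻¹ • (f (unitDir (y + a • z)) - f y) -
      a⁻¹ • (f (unitDir (y + a • z')) - f y)‖) (𝓝[>] 0)
      (𝓝 ‖(z - normDirDeriv y z • y) - (z' - normDirDeriv y z' • y)‖) := by
  refine ((tendsto_unitDir_slope hy z).sub (tendsto_unitDir_slope hy z')).norm.congr' ?_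
  filter_upwards [eventually_pos, eventually_add_smul_ne_zero hy z,
    eventually_add_smul_ne_zero hy z'] with a ha h0 h0'
  rw [← smul_sub, ← smul_sub, norm_smul, norm_smul, sub_sub_sub_cancel_right,
    sub_sub_sub_cancel_right, hiso _ (by simpa using norm_unitDir h0) _
      (by simpa using norm_unitDir h0')]

include hiso in
lemma HasSphereDeriv.norm_sub {y z z' : X} {v v' : E} (hy : ‖y‖ = 1)
    (h : HasSphereDeriv f y z v) (h' : HasSphereDeriv f y z' v') :
    ‖v - v'‖ = ‖(z - normDirDeriv y z • y) - (z' - normDirDeriv y z' • y)‖ :=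
  tendsto_nhds_unique (h.sub h').norm (tendsto_norm_sphere_slope_sub hiso hy z z')

include hiso in
/-- Translating the direction by a multiple of the base point does not change the derivative. -/
lemma HasSphereDeriv.add_smul_self {y z : X} {v : E} (hy : ‖y‖ = 1)
    (h : HasSphereDeriv f y z v) (t : ℝ) : HasSphereDeriv f y (z + t • y) v := by
  have h1 := tendsto_norm_sphere_slope_sub hiso hy (z + t • y) z
  have e : (z + t • y - normDirDeriv y (z + t • y) • y) - (z - normDirDeriv y z • y) = 0 := by
    rw [normDirDeriv_add_smul_self, hy]; module
  rw [e, norm_zero] at h1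
  simpa [HasSphereDeriv] using (tendsto_zero_iff_norm_tendsto_zero.2 h1).add h

include hiso in
/-- Distances to a fixed point of the sphere vary at the same rate on both sides. -/
lemma HasSphereDeriv.normDirDeriv_sub {y z : X} {v : E} (hy : ‖y‖ = 1)
    (hz : normDirDeriv y z = 0) (h : HasSphereDeriv f y z v) {x : X} (hx : ‖x‖ = 1) :
    normDirDeriv (f x - f y) (-v) = normDirDeriv (x - y) (-z) := by
  have h1 := tendsto_unitDir_slope hy z
  rw [hz, zero_smul, sub_zero] at h1
  have hX := tendsto_norm_slope_of_tendsto (x - y) (-z) le_rfl h1.neg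
  have hE := tendsto_norm_slope_of_tendsto (f x - f y) (-v) le_rfl (Tendsto.neg h)
  refine tendsto_nhds_unique hE (hX.congr' ?_)
  filter_upwards [eventually_pos, eventually_add_smul_ne_zero hy z] with a ha h0
  rw [smul_neg, smul_neg, smul_inv_smul₀ ha.ne', smul_inv_smul₀ ha.ne', ← sub_eq_add_neg,
    ← sub_eq_add_neg, sub_sub_sub_cancel_right, sub_sub_sub_cancel_right,
    hiso x (by simpa using hx) _ (by simpa using norm_unitDir h0),
    hiso x (by simpa using hx) y (by simpa using hy)]

omit [NormedSpace ℝ E] in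
/-- A curve on `(0, 1)` whose only cluster values at `0` are two points
converges to one of them. -/
lemma tendsto_or_tendsto_of_ultrafilter {q : ℝ → E} (hq : ContinuousOn q (Ioo 0 1)) {k₁ k₂ : E}
    (hk : k₁ ≠ k₂)
    (H : ∀ 𝒰 : Ultrafilter ℝ, (𝒰 : Filter ℝ) ≤ 𝓝[>] 0 →
      Tendsto q 𝒰 (𝓝 k₁) ∨ Tendsto q 𝒰 (𝓝 k₂)) :
    Tendsto q (𝓝[>] 0) (𝓝 k₁) ∨ Tendsto q (𝓝[>] 0) (𝓝 k₂) := by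
  set θ : ℝ → ℝ := fun a => ‖q a - k₁‖ - ‖q a - k₂‖ with hθ
  have hδ : 0 < ‖k₁ - k₂‖ := norm_pos_iff.2 (sub_ne_zero.2 hk)
  have h1 : ∀ 𝒰 : Ultrafilter ℝ, Tendsto q 𝒰 (𝓝 k₁) → Tendsto θ 𝒰 (𝓝 (-‖k₁ - k₂‖)) := by
    intro 𝒰 h
    simpa using (h.sub_const k₁).norm.sub (h.sub_const k₂).norm
  have h2 : ∀ 𝒰 : Ultrafilter ℝ, Tendsto q 𝒰 (𝓝 k₂) → Tendsto θ 𝒰 (𝓝 ‖k₁ - k₂‖) := by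
    intro 𝒰 h
    simpa [θ, norm_sub_rev k₂ k₁] using (h.sub_const k₁).norm.sub (h.sub_const k₂).norm
  have hne : {a | θ a ≠ 0} ∈ 𝓝[>] (0 : ℝ) := by
    refine mem_iff_ultrafilter.2 fun 𝒰 h𝒰 => ?_
    rcases H 𝒰 h𝒰 with h | h
    · exact (h1 𝒰 h).eventually_ne (by linarith)
    · exact (h2 𝒰 h).eventually_ne hδ.ne'
  obtain ⟨ε, hε, hεs⟩ := mem_nhdsGT_iff_exists_Ioo_subset.1
    (inter_mem hne (Ioo_mem_nhdsGT (zero_lt_one' ℝ)))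
  have hcont : ContinuousOn θ (Ioo 0 ε) := by
    have := hq.mono fun a ha => (hεs ha).2
    fun_prop
  have hmem : Ioo 0 ε ∈ 𝓝[>] (0 : ℝ) := Ioo_mem_nhdsGT hε
  have hsign : (∀ a ∈ Ioo 0 ε, θ a < 0) ∨ (∀ a ∈ Ioo 0 ε, 0 < θ a) := by
    by_contra hcon
    push Not at hcon
    obtain ⟨⟨a, ha, ha0⟩, ⟨b, hb, hb0⟩⟩ := hcon
    obtain ⟨c, hc, hc0⟩ := isPreconnected_Ioo.intermediate_value hb ha hcont ⟨hb0, ha0⟩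
    exact (hεs hc).1 hc0
  rcases hsign with hs | hs
  · left
    refine (tendsto_iff_ultrafilter _ _ _).2 fun 𝒰 h𝒰 => ?_
    refine (H 𝒰 h𝒰).resolve_right fun h => ?_
    obtain ⟨a, ha, ha'⟩ := (((h2 𝒰 h).eventually_const_lt hδ).and (h𝒰 hmem)).exists
    exact (hs a ha').not_gt ha
  · right
    refine (tendsto_iff_ultrafilter _ _ _).2 fun 𝒰 h𝒰 => ?_
    refine (H 𝒰 h𝒰).resolve_left fun h => ?_
    obtain ⟨a, ha, ha'⟩ := (((h1 𝒰 h).eventually_lt_const (neg_lt_zero.2 hδ)).and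
      (h𝒰 hmem)).exists
    exact (hs a ha').not_gt ha

include hmaps hiso in
/-- An isometry between spheres of planes has one-sided derivatives along half-tangents, and they
are half-tangents. -/
lemma exists_hasSphereDeriv [FiniteDimensional ℝ E] {y u : X} (hy : ‖y‖ = 1) (hu : ‖u‖ = 1)
    (hd : normDirDeriv y u = 0) {k₁ k₂ : E} (hk : IsTangentPair (f y) k₁ k₂) :
    HasSphereDeriv f y u k₁ ∨ HasSphereDeriv f y u k₂ := by
  have hys : y ∈ sphere (0 : X) 1 := by simpa using hy
  have hne : ∀ a ∈ Ioo (0 : ℝ) 1, y + a • u ≠ 0 := by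
    intro a ha h0
    have := norm_sub_le (y + a • u) (a • u)
    rw [add_sub_cancel_right, h0, norm_zero, norm_smul, hu, hy, Real.norm_of_nonneg ha.1.le] at this
    linarith [ha.2]
  have hf : ContinuousOn f (sphere 0 1) := by
    refine (LipschitzOnWith.of_dist_le_mul (K := 1) fun x hx x' hx' => ?_).continuousOn
    rw [dist_eq_norm, dist_eq_norm, hiso x hx x' hx', NNReal.coe_one, one_mul]
  refine tendsto_or_tendsto_of_ultrafilter ?_ hk.ne fun 𝒰 h𝒰 => ?_
  · have h1 : ContinuousOn (fun a : ℝ => unitDir (y + a • u)) (Ioo 0 1) := by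
      have h3 : ContinuousOn (fun a : ℝ => ‖y + a • u‖⁻¹) (Ioo 0 1) :=
        ContinuousOn.inv₀ (by fun_prop) fun a ha => norm_ne_zero_iff.2 (hne a ha)
      exact h3.smul (by fun_prop)
    have h2 : ContinuousOn (fun a : ℝ => f (unitDir (y + a • u))) (Ioo 0 1) :=
      hf.comp h1 fun a ha => by simpa using norm_unitDir (hne a ha)
    have h4 : ContinuousOn (fun a : ℝ => a⁻¹) (Ioo 0 1) :=
      continuousOn_inv₀.mono fun a ha => ha.1.ne'
    exact h4.smul (h2.sub continuousOn_const)
  · set q : ℝ → E := fun a => a⁻¹ • (f (unitDir (y + a • u)) - f y) with hq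
    have hnorm : Tendsto (fun a => ‖q a‖) (𝓝[>] 0) (𝓝 1) := by
      have := tendsto_norm_sphere_slope_sub hiso hy u 0
      simpa [normDirDeriv_zero_right, hd, hu, unitDir_of_norm_eq_one hy] using this
    have hball : closedBall (0 : E) 2 ∈ 𝒰.map q := by
      have : ∀ᶠ a in 𝓝[>] (0 : ℝ), ‖q a‖ < 2 := hnorm.eventually_lt_const one_lt_two
      have hev : q ⁻¹' closedBall (0 : E) 2 ∈ (𝒰 : Filter ℝ) := by
        filter_upwards [h𝒰 this] with a ha
        simpa using (show ‖q a‖ < 2 from ha).le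
      exact hev
    obtain ⟨k, -, hkU⟩ := (isCompact_closedBall (0 : E) 2).ultrafilter_le_nhds' _ hball
    have hkt : Tendsto q 𝒰 (𝓝 k) := hkU
    have hk1 : ‖k‖ = 1 := tendsto_nhds_unique hkt.norm (hnorm.mono_left h𝒰)
    have hk0 : normDirDeriv (f y) k = 0 := by
      refine tendsto_nhds_unique (tendsto_norm_slope_of_tendsto (f y) k h𝒰 hkt)
        (tendsto_const_nhds.congr' ?_)
      filter_upwards [h𝒰 eventually_pos, h𝒰 (eventually_add_smul_ne_zero hy u)] with a ha h0
      rw [hq]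
      simp only
      rw [smul_inv_smul₀ ha.ne', add_sub_cancel, hmaps y hys,
        hmaps _ (by simpa using norm_unitDir h0), sub_self, zero_div]
    rcases hk.eq_or_eq hk1 hk0 with rfl | rfl
    · exact Or.inl hkt
    · exact Or.inr hkt

include hmaps hiso in
/-- Half-tangents at `y` are carried to half-tangents at `f y`. -/
lemma exists_isTangentPair_hasSphereDeriv [FiniteDimensional ℝ E]
    (hdimE : Module.finrank ℝ E = 2) {y u₁ u₂ : X} (hu : IsTangentPair y u₁ u₂) :
    ∃ v₁ v₂ : E, IsTangentPair (f y) v₁ v₂ ∧ HasSphereDeriv f y u₁ v₁ ∧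
      HasSphereDeriv f y u₂ v₂ := by
  have hy := hu.norm_base
  obtain ⟨k₁, k₂, hk⟩ := exists_isTangentPair hdimE (hmaps y (by simpa using hy))
  have hne : ∀ k, HasSphereDeriv f y u₁ k → ¬ HasSphereDeriv f y u₂ k := fun k h h' => by
    have := h.norm_sub hiso hy h'
    rw [hu.deriv_left, hu.deriv_right, sub_self, norm_zero, zero_smul, sub_zero, sub_zero] at this
    exact hu.ne (sub_eq_zero.1 (norm_eq_zero.1 this.symm))
  rcases exists_hasSphereDeriv hmaps hiso hy hu.norm_left hu.deriv_left hk with h1 | h1 <;>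
  rcases exists_hasSphereDeriv hmaps hiso hy hu.norm_right hu.deriv_right hk with h2 | h2
  · exact absurd h2 (hne _ h1)
  · exact ⟨k₁, k₂, hk, h1, h2⟩
  · exact ⟨k₂, k₁, hk.symm, h1, h2⟩
  · exact absurd h2 (hne _ h1)

end SphereIsometry

section Corner

variable {X E : Type*} [NormedAddCommGroup X] [NormedSpace ℝ X]
  [NormedAddCommGroup E] [NormedSpace ℝ E]

lemma IsTangentPair.deriv_neg_of_relation {s k₁ k₂ : X} (h : IsTangentPair s k₁ k₂) {c t : ℝ}
    (hc : 0 < c) (hr : k₁ + c • k₂ = (-t) • s) : normDirDeriv s (-k₁) = t := by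
  have : -k₁ = c • k₂ + t • s := by
    have : -k₁ = c • k₂ + t • s - ((k₁ + c • k₂) - (-t) • s) := by module
    rw [this, hr]; simp
  rw [this, h.symm.deriv_comb hc.le]

lemma relation_symm {s k₁ k₂ : X} {c t : ℝ} (hc : 0 < c) (hr : k₁ + c • k₂ = (-t) • s) :
    k₂ + c⁻¹ • k₁ = (-(c⁻¹ * t)) • s := by
  have : k₂ + c⁻¹ • k₁ = c⁻¹ • (k₁ + c • k₂) := by
    rw [smul_add, inv_smul_smul₀ hc.ne', add_comm]
  rw [this, hr]; module

/-- A linear isometry which matches the tangent data of two corners `y` and `s`, and the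
derivatives of the norm at `-y` and `-(s + s') / 2`, carries `y` to `s`. -/
lemma map_corner_eq [FiniteDimensional ℝ X] [FiniteDimensional ℝ E] {y u₁ u₂ : X} {s v₁ v₂ s' : E}
    (hu : IsTangentPair y u₁ u₂) (hv : IsTangentPair s v₁ v₂) {c t c' t' : ℝ}
    (hc : 0 < c) (ht : 0 < t) (hru : u₁ + c • u₂ = (-t) • y)
    (hc' : 0 < c') (ht' : 0 < t') (hrv : v₁ + c' • v₂ = (-t') • s)
    (T : X →L[ℝ] E) (hT : ∀ z, ‖T z‖ = ‖z‖) (hTs : Function.Surjective T)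
    (hT₁ : T u₁ = v₁) (hT₂ : T u₂ = v₂) (hs' : ‖s'‖ = 1) (hss : ‖s + s'‖ = 2)
    (h₁ : normDirDeriv (-(s + s')) (-v₁) = normDirDeriv (-y) (-u₁))
    (h₂ : normDirDeriv (-(s + s')) (-v₂) = normDirDeriv (-y) (-u₂)) : T y = s := by
  obtain ⟨s₀, rfl⟩ := hTs s
  obtain ⟨s₀', rfl⟩ := hTs s'
  have hinj : ∀ z, T z = 0 → z = 0 := fun z hz => by
    rw [← norm_eq_zero, ← hT, hz, norm_zero]
  have hs₀ : ‖s₀‖ = 1 := by rw [← hT, hv.norm_base]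
  have hs₀' : ‖s₀'‖ = 1 := by rw [← hT, hs']
  have hp₁ := hu.deriv_neg_of_relation hc hru
  have hp₂ := hu.symm.deriv_neg_of_relation (inv_pos.2 hc) (relation_symm hc hru)
  have ht₂ : 0 < c⁻¹ * t := by positivity
  set w := (1 / 2 : ℝ) • (s₀ + s₀') with hw
  have hwn : ‖w‖ = 1 := by
    rw [hw, norm_smul, ← hT, map_add, hss]; norm_num
  have hTw : -(T s₀ + T s₀') = T ((2 : ℝ) • (-w)) := by
    rw [← map_add, ← map_neg, hw]
    congr 1
    module
  rw [hTw, ← hT₁, ← map_neg, normDirDeriv_map T hT, normDirDeriv_smul_left _ _ two_pos] at h₁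
  rw [hTw, ← hT₂, ← map_neg, normDirDeriv_map T hT, normDirDeriv_smul_left _ _ two_pos] at h₂
  -- `-w` lies in the cone spanned by `u₁, u₂`
  have hcone : ∃ α β : ℝ, 0 ≤ α ∧ 0 ≤ β ∧ -w = α • u₁ + β • u₂ := by
    have hd : normDirDeriv (T s₀) (T (-w)) ≤ 0 := by
      have h := normDirDeriv_le_sub s₀ ((2 : ℝ) • (-w))
      have e : s₀ + (2 : ℝ) • (-w) = -s₀' := by rw [hw]; module
      rw [e, norm_neg, hs₀, hs₀', sub_self, normDirDeriv_smul_right _ _ zero_le_two] at h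
      rw [normDirDeriv_map T hT]
      linarith
    have hts : T s₀ = (-t'⁻¹) • v₁ + (-(t'⁻¹ * c')) • v₂ := by
      have : (-t'⁻¹) • v₁ + (-(t'⁻¹ * c')) • v₂ = (-t'⁻¹) • (v₁ + c' • v₂) := by module
      rw [this, hrv, smul_smul, neg_mul_neg, inv_mul_cancel₀ ht'.ne', one_smul]
    have hlift : ∀ α β : ℝ, T (-w) = α • v₁ + β • v₂ → -w = α • u₁ + β • u₂ := fun α β h => by
      rw [← sub_eq_zero]
      refine hinj _ ?_
      rw [map_sub, h, map_add, map_smul, map_smul, hT₁, hT₂, sub_self]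
    obtain ⟨μ, τ, hμ, hz | hz⟩ := hv.cover (T (-w))
    · rw [hz, hv.deriv_comb hμ] at hd
      have hnt : 0 ≤ -τ := by linarith
      refine ⟨μ + -τ * t'⁻¹, -τ * (t'⁻¹ * c'), by positivity, by positivity, hlift _ _ ?_⟩
      rw [hz]
      nth_rewrite 1 [hts]
      module
    · rw [hz, hv.symm.deriv_comb hμ] at hd
      have hnt : 0 ≤ -τ := by linarith
      refine ⟨-τ * t'⁻¹, μ + -τ * (t'⁻¹ * c'), by positivity, by positivity, hlift _ _ ?_⟩
      rw [hz]
      nth_rewrite 1 [hts]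
      module
  have hwy : -w = -y := by
    obtain ⟨α, β, hα, hβ, hab⟩ := hcone
    have hd := hu.deriv_cone_nonpos hα hβ
    rw [← hab] at hd
    have hyn : ‖-y‖ = 1 := by rw [norm_neg, hu.norm_base]
    have hwn' : ‖-w‖ = 1 := by rw [norm_neg, hwn]
    obtain ⟨μ, τ, hμ, hz | hz⟩ := hu.cover (-w)
    · rw [hz, hu.deriv_comb hμ] at hd
      refine eq_of_normDirDeriv_eq hyn hwn' hu.norm_left hμ (m := -τ) (by linarith)
        (by rw [hz]; module) h₁ ?_
      rw [normDirDeriv_neg_left, normDirDeriv_neg_left, neg_neg, hu.deriv_left, hp₁]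
      linarith
    · rw [hz, hu.symm.deriv_comb hμ] at hd
      refine eq_of_normDirDeriv_eq hyn hwn' hu.norm_right hμ (m := -τ) (by linarith)
        (by rw [hz]; module) h₂ ?_
      rw [normDirDeriv_neg_left, normDirDeriv_neg_left, neg_neg, hu.deriv_right, hp₂]
      linarith
  have hyw : y = w := (neg_injective hwy).symm
  -- the norm is constant on the segment from `s₀` to `s₀'`, whose midpoint is the corner `y`
  have hd1 := normDirDeriv_le_sub y (s₀ - y)
  have hd2 := normDirDeriv_le_sub y (-(s₀ - y))
  have hd3 := normDirDeriv_add_neg_nonneg y (s₀ - y)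
  have e2 : y + -(s₀ - y) = s₀' := by rw [hyw, hw]; module
  rw [add_sub_cancel, hs₀, hu.norm_base, sub_self] at hd1
  rw [e2, hs₀', hu.norm_base, sub_self] at hd2
  have hz0 : s₀ - y = 0 := by
    obtain ⟨μ, τ, hμ, hz | hz⟩ := hu.cover (s₀ - y)
    · have h0 : τ = 0 := by
        rw [hz, hu.deriv_comb hμ] at hd1 hd3
        rw [hz] at hd2
        linarith
      rw [h0, zero_smul, add_zero] at hz
      rw [hz, ← smul_neg, normDirDeriv_smul_right _ _ hμ, hp₁] at hd2
      have : μ = 0 := by nlinarith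
      rw [hz, this, zero_smul]
    · have h0 : τ = 0 := by
        rw [hz, hu.symm.deriv_comb hμ] at hd1 hd3
        rw [hz] at hd2
        linarith
      rw [h0, zero_smul, add_zero] at hz
      rw [hz, ← smul_neg, normDirDeriv_smul_right _ _ hμ, hp₂] at hd2
      have : μ = 0 := by nlinarith
      rw [hz, this, zero_smul]
  rw [sub_eq_zero.1 hz0]

lemma eq_neg_of_relation {s k₁ k₂ : X} (h : IsTangentPair s k₁ k₂) {c : ℝ} (hc : 0 < c)
    (hr : k₁ + c • k₂ = (-(0 : ℝ)) • s) : c = 1 ∧ k₂ = -k₁ := by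
  rw [neg_zero, zero_smul] at hr
  have hk := eq_neg_of_add_eq_zero_left hr
  have hn := congrArg norm hk
  rw [norm_neg, norm_smul, h.norm_left, h.norm_right, Real.norm_of_nonneg hc.le, mul_one] at hn
  refine ⟨hn.symm, ?_⟩
  rw [hk, ← hn, one_smul, neg_neg]

variable {f : X → E} (hbij : BijOn f (sphere (0 : X) 1) (sphere (0 : E) 1))
  (hiso : ∀ x ∈ sphere (0 : X) 1, ∀ x' ∈ sphere (0 : X) 1, ‖f x - f x'‖ = ‖x - x'‖)

include hbij hiso in
/-- Every linear relation between a point of the sphere and its half-tangents is preserved. -/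
lemma relation_map [FiniteDimensional ℝ X] [FiniteDimensional ℝ E]
    (hdimX : Module.finrank ℝ X = 2) (hdimE : Module.finrank ℝ E = 2)
    {y u₁ u₂ : X} {v₁ v₂ : E} (hu : IsTangentPair y u₁ u₂) (hv : IsTangentPair (f y) v₁ v₂)
    (hd₁ : HasSphereDeriv f y u₁ v₁) (hd₂ : HasSphereDeriv f y u₂ v₂) {c t : ℝ}
    (hc : 0 < c) (ht : 0 ≤ t) (hru : u₁ + c • u₂ = (-t) • y) :
    v₁ + c • v₂ = (-t) • f y := by
  obtain ⟨c', t', hc', ht', hrv⟩ := hv.exists_relation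
  have hy := hu.norm_base
  have hys : y ∈ sphere (0 : X) 1 := by simpa using hy
  have hD₁ : ∀ {x : X}, ‖x‖ = 1 → normDirDeriv (f x - f y) (-v₁) = normDirDeriv (x - y) (-u₁) :=
    fun hx => hd₁.normDirDeriv_sub hiso hy hu.deriv_left hx
  have hD₂ : ∀ {x : X}, ‖x‖ = 1 → normDirDeriv (f x - f y) (-v₂) = normDirDeriv (x - y) (-u₂) :=
    fun hx => hd₂.normDirDeriv_sub hiso hy hu.deriv_right hx
  have hVU : 0 < t' → ∀ α β : ℝ, 0 < α → 0 < β → ‖α • v₁ + β • v₂‖ ≤ ‖α • u₁ + β • u₂‖ := by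
    intro ht' α β hα hβ
    refine norm_comb_le_of_normDirDeriv_eq hdimE (hv.indep_of_relation hc' ht' hrv) ?_ hα hβ
    intro α β hα hβ
    obtain ⟨a, ha, ha1⟩ := exists_norm_add_smul_eq_one hv.norm_base
      (hv.deriv_cone_neg hc' ht' hrv hα hβ)
    obtain ⟨x, hx, hfx⟩ := hbij.surjOn (show f y + a • (α • v₁ + β • v₂) ∈ sphere (0 : E) 1 by
      simpa using ha1)
    have hx1 : ‖x‖ = 1 := by simpa using hx
    have e : f x - f y = a • (α • v₁ + β • v₂) := by rw [hfx, add_sub_cancel_left]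
    refine ⟨x - y, ?_, ?_⟩
    · rw [← hD₁ hx1, e, normDirDeriv_smul_left _ _ ha]
    · rw [← hD₂ hx1, e, normDirDeriv_smul_left _ _ ha]
  have hUV : 0 < t → ∀ α β : ℝ, 0 < α → 0 < β → ‖α • u₁ + β • u₂‖ ≤ ‖α • v₁ + β • v₂‖ := by
    intro ht α β hα hβ
    refine norm_comb_le_of_normDirDeriv_eq hdimX (hu.indep_of_relation hc ht hru) ?_ hα hβ
    intro α β hα hβ
    obtain ⟨a, ha, ha1⟩ := exists_norm_add_smul_eq_one hy (hu.deriv_cone_neg hc ht hru hα hβ)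
    have e : (y + a • (α • u₁ + β • u₂)) - y = a • (α • u₁ + β • u₂) := add_sub_cancel_left _ _
    refine ⟨f (y + a • (α • u₁ + β • u₂)) - f y, ?_, ?_⟩
    · rw [hD₁ ha1, e, normDirDeriv_smul_left _ _ ha]
    · rw [hD₂ ha1, e, normDirDeriv_smul_left _ _ ha]
  rcases ht.eq_or_lt with rfl | htp
  · obtain ⟨rfl, hu2⟩ := eq_neg_of_relation hu hc hru
    have hv2 : v₁ + v₂ = 0 := by
      rcases ht'.eq_or_lt with rfl | htp'
      · rw [(eq_neg_of_relation hv hc' hrv).2, add_neg_cancel]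
      · have := hVU htp' 1 1 one_pos one_pos
        simpa [hu2] using this
    simpa using hv2
  have htp' : 0 < t' := by
    refine ht'.lt_of_ne' ?_
    rintro rfl
    have h0 := hUV htp 1 1 one_pos one_pos
    rw [(eq_neg_of_relation hv hc' hrv).2, one_smul, one_smul, one_smul, one_smul,
      add_neg_cancel, norm_zero] at h0
    have h1 := (hu.indep_of_relation hc htp hru 1 1 (by simpa using h0)).1
    exact one_ne_zero h1
  have hopp : ∀ α β : ℝ, 0 ≤ α → 0 ≤ β → ‖α • v₁ - β • v₂‖ = ‖α • u₁ - β • u₂‖ := by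
    intro α β hα hβ
    have := (hd₁.smul hy hα).norm_sub hiso hy (hd₂.smul hy hβ)
    rw [normDirDeriv_smul_right _ _ hα, normDirDeriv_smul_right _ _ hβ, hu.deriv_left,
      hu.deriv_right] at this
    simpa using this
  have hnn : ∀ α β : ℝ, 0 ≤ α → ‖α • v₁ + β • v₂‖ = ‖α • u₁ + β • u₂‖ := by
    intro α β hα
    rcases le_or_gt β 0 with hβ | hβ
    · have := hopp α (-β) hα (by linarith)
      simpa using this
    · rcases hα.eq_or_lt with rfl | hα
      · simp [norm_smul, hu.norm_right, hv.norm_right]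
      · exact le_antisymm (hVU htp' α β hα hβ) (hUV htp α β hα hβ)
  have hall : ∀ α β : ℝ, ‖α • v₁ + β • v₂‖ = ‖α • u₁ + β • u₂‖ := by
    intro α β
    rcases le_total 0 α with hα | hα
    · exact hnn α β hα
    · have := hnn (-α) (-β) (by linarith)
      have e1 : -α • v₁ + -β • v₂ = -(α • v₁ + β • v₂) := by module
      have e2 : -α • u₁ + -β • u₂ = -(α • u₁ + β • u₂) := by module
      rwa [e1, e2, norm_neg, norm_neg] at this
  obtain ⟨c₁, c₂, hcz, h11, h12, h21, h22⟩ :=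
    exists_coord_of_finrank_two hdimX (hu.indep_of_relation hc htp hru)
  obtain ⟨d₁, d₂, hdz, -⟩ :=
    exists_coord_of_finrank_two hdimE (hv.indep_of_relation hc' htp' hrv)
  let T : X →L[ℝ] E := c₁.smulRight v₁ + c₂.smulRight v₂
  have hTz : ∀ z, T z = c₁ z • v₁ + c₂ z • v₂ := fun z => rfl
  have hT₁ : T u₁ = v₁ := by rw [hTz, h11, h21]; simp
  have hT₂ : T u₂ = v₂ := by rw [hTz, h12, h22]; simp
  have hT : ∀ z, ‖T z‖ = ‖z‖ := fun z => by rw [hTz, hall, ← hcz]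
  have hTs : Function.Surjective T := fun e => by
    refine ⟨d₁ e • u₁ + d₂ e • u₂, ?_⟩
    rw [map_add, map_smul, map_smul, hT₁, hT₂, ← hdz]
  have hny : ‖-y‖ = 1 := by rw [norm_neg, hy]
  have hnys : -y ∈ sphere (0 : X) 1 := by simpa using hy
  have e1 : -(f y + -f (-y)) = f (-y) - f y := by abel
  have e2 : -y - y = (2 : ℝ) • (-y) := by module
  have hTy : T y = f y := by
    refine map_corner_eq hu hv hc htp hru hc' htp' hrv T hT hTs hT₁ hT₂ (s' := -f (-y)) ?_ ?_ ?_ ?_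
    · rw [norm_neg]; simpa using hbij.mapsTo hnys
    · rw [← sub_eq_add_neg, norm_sub_rev, hiso _ hnys _ hys, e2, norm_smul, hny]; norm_num
    · rw [e1, hD₁ hny, e2, normDirDeriv_smul_left _ _ two_pos]
    · rw [e1, hD₂ hny, e2, normDirDeriv_smul_left _ _ two_pos]
  rw [← hT₁, ← hT₂, ← hTy, ← map_smul, ← map_smul, ← map_add, hru]

end Corner

section HomogeneousExtension

variable {X E : Type*} [NormedAddCommGroup X] [NormedSpace ℝ X]
  [NormedAddCommGroup E] [NormedSpace ℝ E] {f : X → E}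

lemma homExt_smul (f : X → E) {c : ℝ} (hc : 0 < c) (x : X) :
    homExt f (c • x) = c • homExt f x := by
  rw [homExt, homExt, unitDir_smul hc, norm_smul, Real.norm_of_nonneg hc.le, mul_smul]

lemma GateauxAt.smul_homExt {y : X} (h : GateauxAt (homExt f) y) {c : ℝ} (hc : 0 < c) :
    GateauxAt (homExt f) (c • y) := by
  obtain ⟨L, hL⟩ := h
  refine ⟨L, fun z => ((hL z).comp (tendsto_mul_nhdsGT (inv_pos.2 hc))).congr' ?_⟩
  filter_upwards [eventually_pos] with a ha
  have : c • y + a • z = c • (y + (c⁻¹ * a) • z) := by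
    rw [smul_add, smul_smul, mul_inv_cancel_left₀ hc.ne']
  simp only [Function.comp]
  rw [this, homExt_smul f hc, homExt_smul f hc, ← smul_sub, smul_smul]
  congr 1
  field_simp

/-- The homogeneous extension of an isometry of spheres is Lipschitz. -/
lemma lipschitzWith_homExt (hmaps : MapsTo f (sphere (0 : X) 1) (sphere (0 : E) 1))
    (hiso : ∀ x ∈ sphere (0 : X) 1, ∀ x' ∈ sphere (0 : X) 1, ‖f x - f x'‖ = ‖x - x'‖) :
    LipschitzWith 3 (homExt f) := by
  refine LipschitzWith.of_dist_le_mul fun x x' => ?_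
  rw [dist_eq_norm, dist_eq_norm]
  change _ ≤ (3 : ℝ) * _
  have hn : ∀ v : X, v ≠ 0 → ‖f (unitDir v)‖ = 1 := fun v hv => by
    simpa using hmaps (show unitDir v ∈ sphere (0 : X) 1 by simpa using norm_unitDir hv)
  have hN : ∀ v : X, ‖homExt f v‖ = ‖v‖ := fun v => by
    rcases eq_or_ne v 0 with rfl | hv
    · simp [homExt]
    · rw [homExt, norm_smul, hn v hv, norm_norm, mul_one]
  rcases eq_or_ne x 0 with rfl | hx
  · have : homExt f (0 : X) = 0 := by simp [homExt]
    rw [this, zero_sub, zero_sub, norm_neg, norm_neg, hN]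
    linarith [norm_nonneg x']
  rcases eq_or_ne x' 0 with rfl | hx'
  · have : homExt f (0 : X) = 0 := by simp [homExt]
    rw [this, sub_zero, sub_zero, hN]
    linarith [norm_nonneg x]
  have e1 : homExt f x - homExt f x' = ‖x‖ • (f (unitDir x) - f (unitDir x')) +
      (‖x‖ - ‖x'‖) • f (unitDir x') := by rw [homExt, homExt]; module
  have e2 : ‖x‖ • (unitDir x - unitDir x') = (x - x') - (‖x‖ - ‖x'‖) • unitDir x' := by
    rw [smul_sub, sub_smul, norm_smul_unitDir, norm_smul_unitDir]; abel
  have h1 : ‖‖x‖ • (f (unitDir x) - f (unitDir x'))‖ ≤ ‖x - x'‖ + |‖x‖ - ‖x'‖| := by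
    rw [norm_smul, hiso _ (by simpa using norm_unitDir hx) _ (by simpa using norm_unitDir hx'),
      ← norm_smul, e2]
    refine (norm_sub_le _ _).trans ?_
    rw [norm_smul, norm_unitDir hx', mul_one, Real.norm_eq_abs]
  have h2 : ‖(‖x‖ - ‖x'‖) • f (unitDir x')‖ = |‖x‖ - ‖x'‖| := by
    rw [norm_smul, hn x' hx', mul_one, Real.norm_eq_abs]
  have h3 := abs_norm_sub_norm_le x x'
  rw [e1]
  refine (norm_add_le _ _).trans ?_
  linarith

lemma finrank_le_of_sphere_isometry [FiniteDimensional ℝ X] [FiniteDimensional ℝ E]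
    (hbij : BijOn f (sphere (0 : X) 1) (sphere (0 : E) 1))
    (hiso : ∀ x ∈ sphere (0 : X) 1, ∀ x' ∈ sphere (0 : X) 1, ‖f x - f x'‖ = ‖x - x'‖) :
    Module.finrank ℝ E ≤ Module.finrank ℝ X := by
  have hsurj : Function.Surjective (homExt f) := fun e => by
    rcases eq_or_ne e 0 with rfl | he
    · exact ⟨0, by simp [homExt]⟩
    · obtain ⟨x, hx, hfx⟩ := hbij.surjOn (show unitDir e ∈ sphere (0 : E) 1 by
        simpa using norm_unitDir he)
      have hx1 : ‖x‖ = 1 := by simpa using hx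
      refine ⟨‖e‖ • x, ?_⟩
      rw [homExt_smul f (norm_pos_iff.2 he), homExt, hx1, one_smul, unitDir_of_norm_eq_one hx1,
        hfx, norm_smul_unitDir]
  have h := (lipschitzWith_homExt hbij.mapsTo hiso).dimH_range_le
  rw [hsurj.range_eq, Real.dimH_univ_eq_finrank, Real.dimH_univ_eq_finrank] at h
  exact_mod_cast h

lemma finrank_eq_of_sphere_isometry [FiniteDimensional ℝ X] [FiniteDimensional ℝ E]
    (hbij : BijOn f (sphere (0 : X) 1) (sphere (0 : E) 1))
    (hiso : ∀ x ∈ sphere (0 : X) 1, ∀ x' ∈ sphere (0 : X) 1, ‖f x - f x'‖ = ‖x - x'‖) :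
    Module.finrank ℝ E = Module.finrank ℝ X := by
  refine le_antisymm (finrank_le_of_sphere_isometry hbij hiso) ?_
  have hinv := hbij.invOn_invFunOn
  have hbij' := hbij.symm hinv.symm
  refine finrank_le_of_sphere_isometry hbij' fun e he e' he' => ?_
  rw [← hiso _ (hbij'.mapsTo he) _ (hbij'.mapsTo he'), hinv.2 he, hinv.2 he']

lemma HasSphereDeriv.tendsto_homExt {y z : X} {v : E} (hy : ‖y‖ = 1)
    (h : HasSphereDeriv f y z v) :
    Tendsto (fun a : ℝ => a⁻¹ • (homExt f (y + a • z) - homExt f y)) (𝓝[>] 0)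
      (𝓝 (v + normDirDeriv y z • f y)) := by
  have h1 : Tendsto (fun a : ℝ => ‖y + a • z‖) (𝓝[>] 0) (𝓝 1) := by
    simpa [hy] using (tendsto_add_smul y z).norm
  have h2 := (h1.smul h).add ((tendsto_normDirDeriv y z).smul_const (f y))
  rw [one_smul] at h2
  refine h2.congr fun a => ?_
  rw [homExt, homExt, hy, unitDir_of_norm_eq_one hy, div_eq_inv_mul]
  module

end HomogeneousExtension

/-- **Corollary.** If `dim X = 2`, then the homogeneous extension `F` of `f` is Gateaux
differentiable at every nonzero point. -/
theorem gateaux_of_dim_two {X E : Type*} [NormedAddCommGroup X] [NormedSpace ℝ X]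
    [FiniteDimensional ℝ X] [NormedAddCommGroup E] [NormedSpace ℝ E] [FiniteDimensional ℝ E]
    (hdim : Module.finrank ℝ X = 2)
    (f : X → E) (hbij : Set.BijOn f (sphere (0 : X) 1) (sphere (0 : E) 1))
    (hiso : ∀ x ∈ sphere (0 : X) 1, ∀ x' ∈ sphere (0 : X) 1, ‖f x - f x'‖ = ‖x - x'‖) :
    ∀ y : X, y ≠ 0 → GateauxAt (homExt f) y := by
  intro y hy0
  have hdimE : Module.finrank ℝ E = 2 := (finrank_eq_of_sphere_isometry hbij hiso).trans hdim
  suffices H : ∀ y : X, ‖y‖ = 1 → GateauxAt (homExt f) y by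
    rw [← norm_smul_unitDir y]
    exact (H _ (norm_unitDir hy0)).smul_homExt (norm_pos_iff.2 hy0)
  intro y hy
  have hmaps : ∀ x ∈ sphere (0 : X) 1, ‖f x‖ = 1 := fun x hx => by simpa using hbij.mapsTo hx
  obtain ⟨u₁, u₂, hu⟩ := exists_isTangentPair hdim hy
  obtain ⟨v₁, v₂, hv, hd₁, hd₂⟩ := exists_isTangentPair_hasSphereDeriv hmaps hiso hdimE hu
  obtain ⟨c, t, hc, ht, hru⟩ := hu.exists_relation
  have hrv := relation_map hbij hiso hdim hdimE hu hv hd₁ hd₂ hc ht hru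
  obtain ⟨c₁, c₂, -, h11, h12, h21, h22⟩ := exists_coord_of_finrank_two hdim hu.indep_base
  let L : X →L[ℝ] E := c₁.smulRight v₁ + c₂.smulRight (f y)
  have hLz : ∀ z, L z = c₁ z • v₁ + c₂ z • f y := fun z => rfl
  have hL₁ : L u₁ = v₁ := by rw [hLz, h11, h21]; simp
  have hLy : L y = f y := by rw [hLz, h12, h22]; simp
  have hL₂ : L u₂ = v₂ := by
    have h1 : L (u₁ + c • u₂) = v₁ + c • v₂ := by rw [hru, map_smul, hLy, hrv]
    rw [map_add, hL₁, map_smul, add_right_inj] at h1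
    exact smul_right_injective E hc.ne' h1
  refine ⟨L, fun z => ?_⟩
  obtain ⟨μ, τ, hμ, rfl | rfl⟩ := hu.cover z
  · have := ((hd₁.smul hy hμ).add_smul_self hiso hy τ).tendsto_homExt hy
    rwa [hu.deriv_comb hμ, ← hL₁, ← hLy, ← map_smul, ← map_smul, ← map_add] at this
  · have := ((hd₂.smul hy hμ).add_smul_self hiso hy τ).tendsto_homExt hy
    rwa [hu.symm.deriv_comb hμ, ← hL₂, ← hLy, ← map_smul, ← map_smul, ← map_add] at this
end
end

section
/- Let X and E be finite-dimensional real normed spaces such that X is smooth (every point of S_X is a smooth point), f : S_X → S_E a bijective isometry, and F its positively homogeneous extension. Then F is Gateaux differentiable at every nonzero point of X. -/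
open Filter Topology Metric Set MeasureTheory

noncomputable section

/-- A norm on a finite-dimensional space is differentiable at every smooth point. -/
theorem IsSmoothPt.differentiableAt_norm {X : Type*} [NormedAddCommGroup X] [NormedSpace ℝ X]
    [FiniteDimensional ℝ X] {x : X} (hx : ‖x‖ = 1) (h : IsSmoothPt x) :
    DifferentiableAt ℝ (‖·‖) x := by
  obtain ⟨g, hg⟩ := h
  have hgmem : g ∈ suppFn X x := by rw [hg]; exact mem_singleton g
  choose φ hφ1 hφ2 using fun z : X => exists_dual_vector'' ℝ z
  have hφ : Tendsto φ (𝓝 x) (𝓝 g) := by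
    have hK : IsCompact (closedBall (0 : X →L[ℝ] ℝ) 1) :=
      haveI : ProperSpace (X →L[ℝ] ℝ) := FiniteDimensional.proper ℝ _
      isCompact_closedBall 0 1
    refine hK.tendsto_nhds_of_unique_mapClusterPt
      (Eventually.of_forall fun z => by simpa using hφ1 z) fun ψ hψ hcl => ?_
    have hψ1 : ‖ψ‖ ≤ 1 := by simpa using hψ
    have hlim : Tendsto (fun z => φ z x) (𝓝 x) (𝓝 1) := by
      have hbd : ∀ z, |φ z x - ‖z‖| ≤ ‖x - z‖ := fun z => by
        have h1 := (φ z).le_of_opNorm_le (hφ1 z) (x - z)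
        have h2 : φ z z = ‖z‖ := hφ2 z
        rwa [map_sub, h2, Real.norm_eq_abs, one_mul] at h1
      have hz : Tendsto (fun z : X => ‖x - z‖) (𝓝 x) (𝓝 0) := by
        have : Continuous fun z : X => ‖x - z‖ := by fun_prop
        simpa using this.tendsto x
      have h0 : Tendsto (fun z => φ z x - ‖z‖) (𝓝 x) (𝓝 0) :=
        squeeze_zero_norm hbd hz
      simpa [hx] using h0.add (continuous_norm.tendsto x)
    have hψx : ψ x = 1 := by
      have hev : ContinuousAt (fun L : X →L[ℝ] ℝ => L x) ψ := by fun_prop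
      have hcl' : MapClusterPt (ψ x) (𝓝 x) fun z => φ z x := hcl.continuousAt_comp hev
      exact t2_iff_nhds.1 inferInstance (hcl'.neBot.mono (inf_le_inf_left _ hlim))
    have hψ2 : 1 ≤ ‖ψ‖ := by
      have := ψ.le_opNorm x
      rw [hψx, hx] at this
      simpa using this
    have : ψ ∈ suppFn X x := ⟨le_antisymm hψ1 hψ2, hψx⟩
    rwa [hg] at this
  refine HasFDerivAt.differentiableAt (f' := g) ?_
  rw [hasFDerivAt_iff_isLittleO, Asymptotics.isLittleO_iff]
  intro c hc
  filter_upwards [Metric.tendsto_nhds.1 hφ c hc] with z hz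
  have h1 : g z ≤ ‖z‖ := by
    have := (le_abs_self _).trans (g.le_opNorm z)
    rwa [hgmem.1, one_mul] at this
  have h2 : φ z x ≤ 1 := by
    have := (le_abs_self _).trans ((φ z).le_of_opNorm_le (hφ1 z) x)
    rwa [hx, one_mul] at this
  have h3 : (φ z - g) (z - x) ≤ c * ‖z - x‖ :=
    (le_abs_self _).trans ((φ z - g).le_of_opNorm_le (by rw [← dist_eq_norm]; exact hz.le) _)
  have h4 : φ z z = ‖z‖ := hφ2 z
  have h5 : g x = 1 := hgmem.2
  simp only [sub_apply, map_sub] at h3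
  rw [hx, map_sub, Real.norm_eq_abs, abs_of_nonneg] <;> linarith

/-- If every gradient of the norm in a direction pointing from the sphere to `w` kills `v`,
then `v = 0`. -/
theorem eq_zero_of_fderiv_norm_sub_eq_zero {E : Type*} [NormedAddCommGroup E] [NormedSpace ℝ E]
    [FiniteDimensional ℝ E] {w v : E} (hw : ‖w‖ = 1)
    (h : ∀ p : E, ‖p‖ = 1 → DifferentiableAt ℝ (‖·‖) (w - p) →
      fderiv ℝ (‖·‖) (w - p) v = 0) : v = 0 := by
  have hnt : Nontrivial E := ⟨w, 0, fun h0 => by simp [h0] at hw⟩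
  let C : Set E := {d | ∃ t : ℝ, 0 < t ∧ ‖w - t • d‖ < 1}
  have hC : IsOpen C := by
    have : C = ⋃ t : ℝ, {d | 0 < t ∧ ‖w - t • d‖ < 1} := by ext; simp [C]
    rw [this]
    refine isOpen_iUnion fun t => isOpen_const.and (isOpen_lt (by fun_prop) continuous_const)
  have hgrad : ∀ d ∈ C, DifferentiableAt ℝ (‖·‖) d → fderiv ℝ (‖·‖) d v = 0 := by
    rintro d ⟨t, ht, htd⟩ hd
    have hd0 : d ≠ 0 := fun h0 => not_differentiableAt_norm_zero E (h0 ▸ hd)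
    have hdpos : 0 < ‖d‖ := norm_pos_iff.2 hd0
    have hcont : Continuous fun s : ℝ => ‖w - s • d‖ := by fun_prop
    have hlarge : 1 ≤ ‖w - (t + 2 / ‖d‖) • d‖ := by
      have h1 := norm_sub_norm_le ((t + 2 / ‖d‖) • d) w
      rw [norm_smul, Real.norm_of_nonneg (by positivity), hw, norm_sub_rev, add_mul,
        div_mul_cancel₀ _ hdpos.ne'] at h1
      nlinarith [mul_pos ht hdpos]
    obtain ⟨s, hs, hs1⟩ := intermediate_value_Icc (a := t) (b := t + 2 / ‖d‖)
      (le_add_of_nonneg_right (by positivity)) hcont.continuousOn ⟨htd.le, hlarge⟩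
    have hspos : 0 < s := ht.trans_le hs.1
    have h1 := h (w - s • d) hs1
    rw [sub_sub_cancel, fderiv_norm_smul_pos hspos] at h1
    exact h1 ((differentiableAt_norm_smul hspos.ne').1 hd)
  have hmono : ∀ d ∈ C, ∀ s : ℝ, ‖d‖ ≤ ‖d + s • v‖ := by
    intro d hd s
    have hcl : d ∈ closure (C ∩ {x : E | DifferentiableAt ℝ (‖·‖) x}) :=
      dense_differentiableAt_norm.open_subset_closure_inter hC hd
    have hclosed : IsClosed {x : E | ‖x‖ ≤ ‖x + s • v‖} :=
      isClosed_le continuous_norm (by fun_prop)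
    refine hclosed.closure_subset_iff.2 ?_ hcl
    rintro x ⟨hxC, hx⟩
    have h1 := (le_abs_self _).trans
      ((fderiv ℝ (‖·‖) x).le_of_opNorm_le (norm_fderiv_norm hx).le (x + s • v))
    rwa [map_add, map_smul, hgrad x hxC hx, hx.fderiv_norm_self, smul_zero, add_zero,
      one_mul] at h1
  have hwC : w ∈ C := ⟨1, one_pos, by simp⟩
  have hsmall : ∀ᶠ s : ℝ in 𝓝 0, ‖w + s • v‖ ≤ 1 := by
    have hcont : Continuous fun s : ℝ => w + s • v := by fun_prop
    filter_upwards [hcont.continuousAt.preimage_mem_nhds (hC.mem_nhds (by simpa using hwC))]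
      with s hs
    have := hmono _ hs (-s)
    rwa [neg_smul, add_neg_cancel_right, hw] at this
  have hall : ∀ r : ℝ, ‖w + r • v‖ ≤ 1 := by
    intro r
    suffices hr : w + r • v ∈ C by
      have := hmono _ hr (-r)
      rwa [neg_smul, add_neg_cancel_right, hw] at this
    have hlim : Tendsto (fun t : ℝ => -(t / (1 - t) * r)) (𝓝 0) (𝓝 0) := by
      have : ContinuousAt (fun t : ℝ => -(t / (1 - t) * r)) 0 := by
        fun_prop (disch := norm_num)
      simpa [ContinuousAt] using this
    have hev : ∀ᶠ t : ℝ in 𝓝[>] 0, 0 < t ∧ t < 1 ∧ ‖w + (-(t / (1 - t) * r)) • v‖ ≤ 1 := by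
      filter_upwards [self_mem_nhdsWithin, nhdsWithin_le_nhds (Iio_mem_nhds one_pos),
        nhdsWithin_le_nhds (hlim.eventually hsmall)] with t h1 h2 h3
      exact ⟨h1, h2, h3⟩
    obtain ⟨t, ht0, ht1, ht⟩ := hev.exists
    have h1t : 0 < 1 - t := sub_pos.2 ht1
    refine ⟨t, ht0, ?_⟩
    have heq : w - t • (w + r • v) = (1 - t) • (w + (-(t / (1 - t) * r)) • v) := by
      match_scalars <;> field_simp
    rw [heq, norm_smul, Real.norm_of_nonneg h1t.le]
    nlinarith
  by_contra hv
  have hvpos : 0 < ‖v‖ := norm_pos_iff.2 hv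
  have h1 := norm_sub_le (w + (3 / ‖v‖) • v) w
  rw [add_sub_cancel_left, norm_smul, Real.norm_of_nonneg (by positivity),
    div_mul_cancel₀ _ hvpos.ne', hw] at h1
  linarith [hall (3 / ‖v‖)]

/-- The gradients of the norm in directions pointing from the sphere to `w` span the dual. -/
theorem span_fderiv_norm_sub_eq_top {E : Type*} [NormedAddCommGroup E] [NormedSpace ℝ E]
    [FiniteDimensional ℝ E] {w : E} (hw : ‖w‖ = 1) :
    Submodule.span ℝ {φ : Module.Dual ℝ E | ∃ p : E, ‖p‖ = 1 ∧
      DifferentiableAt ℝ (‖·‖) (w - p) ∧ φ = (fderiv ℝ (‖·‖) (w - p)).toLinearMap} = ⊤ := by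
  refine Submodule.span_eq_top_of_ne_zero fun v hv => ?_
  contrapose! hv
  exact eq_zero_of_fderiv_norm_sub_eq_zero hw fun p hp hd => hv _ ⟨p, hp, hd, rfl⟩

/-- If all linear functionals in a spanning set of the dual are differentiable along `f`, then
`f` is differentiable. -/
theorem differentiableWithinAt_of_span_dual_eq_top {X E : Type*} [NormedAddCommGroup X]
    [NormedSpace ℝ X] [NormedAddCommGroup E] [NormedSpace ℝ E] [FiniteDimensional ℝ E]
    {f : X → E} {s : Set X} {y : X} {D : Set (Module.Dual ℝ E)}
    (hD : Submodule.span ℝ D = ⊤) (h : ∀ φ ∈ D, DifferentiableWithinAt ℝ (fun z => φ (f z)) s y) :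
    DifferentiableWithinAt ℝ f s y := by
  have hall : ∀ φ : Module.Dual ℝ E, DifferentiableWithinAt ℝ (fun z => φ (f z)) s y := by
    intro φ
    have hφ : φ ∈ Submodule.span ℝ D := hD ▸ Submodule.mem_top
    induction hφ using Submodule.span_induction with
    | mem φ hφ => exact h φ hφ
    | zero => exact differentiableWithinAt_const 0
    | add φ ψ _ _ h1 h2 => exact h1.add h2
    | smul c φ _ h1 => exact h1.const_smul c
  let e := (Module.finBasis ℝ E).equivFun.toContinuousLinearEquiv
  rw [← e.comp_differentiableWithinAt_iff, differentiableWithinAt_pi]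
  exact fun i => hall ((Module.finBasis ℝ E).coord i)

/-- An isometry between the unit spheres of a smooth space and another space is differentiable
along the sphere. -/
theorem differentiableWithinAt_of_sphere_isometry {X E : Type*} [NormedAddCommGroup X]
    [NormedSpace ℝ X] [NormedAddCommGroup E] [NormedSpace ℝ E] [FiniteDimensional ℝ E]
    (hX : ∀ x : X, x ≠ 0 → DifferentiableAt ℝ (‖·‖) x)
    {f : X → E} (hbij : Set.BijOn f (sphere (0 : X) 1) (sphere (0 : E) 1))
    (hiso : ∀ x ∈ sphere (0 : X) 1, ∀ x' ∈ sphere (0 : X) 1, ‖f x - f x'‖ = ‖x - x'‖)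
    {y : X} (hy : y ∈ sphere (0 : X) 1) :
    DifferentiableWithinAt ℝ f (sphere (0 : X) 1) y := by
  have hfy : ‖f y‖ = 1 := by simpa using hbij.mapsTo hy
  have hnt : Nontrivial E := ⟨f y, 0, fun h0 => by simp [h0] at hfy⟩
  refine differentiableWithinAt_of_span_dual_eq_top (span_fderiv_norm_sub_eq_top hfy) ?_
  rintro _ ⟨p, hp, hd, rfl⟩
  obtain ⟨x, hx, rfl⟩ := hbij.surjOn (by simpa using hp : p ∈ sphere (0 : E) 1)
  have hyx : y - x ≠ 0 := by
    intro h0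
    rw [sub_eq_zero.1 h0, sub_self] at hd
    exact not_differentiableAt_norm_zero E hd
  set L := fderiv ℝ (‖·‖) (f y - f x)
  have hnorm : HasFDerivWithinAt (fun z : X => ‖z - x‖) (fderiv ℝ (‖·‖) (y - x))
      (sphere (0 : X) 1) y := by
    have h1 : HasFDerivAt (fun z : X => z - x) (ContinuousLinearMap.id ℝ X) y :=
      (hasFDerivAt_id y).sub_const x
    exact ((hX _ hyx).hasFDerivAt.comp y h1).hasFDerivWithinAt
  have hfcont : Tendsto f (𝓝[sphere (0 : X) 1] y) (𝓝 (f y)) := by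
    rw [tendsto_iff_norm_sub_tendsto_zero]
    have hz : Tendsto (fun z : X => ‖z - y‖) (𝓝[sphere (0 : X) 1] y) (𝓝 0) := by
      have : Continuous fun z : X => ‖z - y‖ := by fun_prop
      simpa using (this.tendsto y).mono_left nhdsWithin_le_nhds
    refine hz.congr' ?_
    filter_upwards [self_mem_nhdsWithin] with z hz
    exact (hiso z hz y hy).symm
  have hE : (fun z => ‖f z - f x‖ - ‖f y - f x‖ - L (f z - f y)) =o[𝓝[sphere (0 : X) 1] y]
      fun z => z - y := by
    have h1 : HasFDerivAt (fun q : E => ‖q - f x‖) L (f y) :=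
      hd.hasFDerivAt.comp (f y) ((hasFDerivAt_id (f y)).sub_const (f x))
    refine (h1.isLittleO.comp_tendsto hfcont).trans_isBigO (Asymptotics.IsBigO.of_bound 1 ?_)
    filter_upwards [self_mem_nhdsWithin] with z hz
    simp [hiso z hz y hy]
  refine HasFDerivWithinAt.differentiableWithinAt (f' := fderiv ℝ (‖·‖) (y - x)) ?_
  rw [hasFDerivWithinAt_iff_isLittleO] at hnorm ⊢
  refine (hnorm.sub hE).congr' ?_ EventuallyEq.rfl
  filter_upwards [self_mem_nhdsWithin] with z hz
  rw [hiso z hz x hx, hiso y hy x hx, map_sub L]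
  simp only [ContinuousLinearMap.coe_coe]
  ring

/-- A function differentiable along the unit sphere of a space with differentiable norm has a
positively homogeneous extension differentiable away from `0`. -/
theorem differentiableAt_homExt {X E : Type*} [NormedAddCommGroup X] [NormedSpace ℝ X]
    [NormedAddCommGroup E] [NormedSpace ℝ E] {f : X → E} {y : X} (hy : y ≠ 0)
    (hnorm : DifferentiableAt ℝ (‖·‖) y)
    (hf : DifferentiableWithinAt ℝ f (sphere (0 : X) 1) (unitDir y)) :
    DifferentiableAt ℝ (homExt f) y := by
  have hunit : DifferentiableAt ℝ (unitDir : X → X) y :=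
    (hnorm.inv (norm_ne_zero_iff.2 hy)).smul differentiableAt_id
  have hmaps : MapsTo (unitDir : X → X) {0}ᶜ (sphere (0 : X) 1) := fun z hz => by
    simpa [unitDir, norm_smul] using inv_mul_cancel₀ (norm_ne_zero_iff.2 hz)
  have hcomp : DifferentiableAt ℝ (fun z => f (unitDir z)) y :=
    (hf.comp y hunit.differentiableWithinAt hmaps).differentiableAt
      (isOpen_compl_singleton.mem_nhds hy)
  exact hnorm.smul hcomp

theorem DifferentiableAt.gateauxAt {X E : Type*} [NormedAddCommGroup X] [NormedSpace ℝ X]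
    [NormedAddCommGroup E] [NormedSpace ℝ E] {F : X → E} {y : X}
    (h : DifferentiableAt ℝ F y) : GateauxAt F y :=
  ⟨fderiv ℝ F y, fun z => (h.hasFDerivAt.hasLineDerivAt z).tendsto_slope_zero_right⟩

/-- **Corollary.** If `X` is smooth (every point of `S_X` is a smooth point), then the
homogeneous extension `F` of `f` is Gateaux differentiable at every nonzero point. -/
theorem gateaux_of_smooth_space {X E : Type*} [NormedAddCommGroup X] [NormedSpace ℝ X]
    [FiniteDimensional ℝ X] [NormedAddCommGroup E] [NormedSpace ℝ E] [FiniteDimensional ℝ E]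
    (hsmooth : ∀ x ∈ sphere (0 : X) 1, IsSmoothPt x)
    (f : X → E) (hbij : Set.BijOn f (sphere (0 : X) 1) (sphere (0 : E) 1))
    (hiso : ∀ x ∈ sphere (0 : X) 1, ∀ x' ∈ sphere (0 : X) 1, ‖f x - f x'‖ = ‖x - x'‖) :
    ∀ y : X, y ≠ 0 → GateauxAt (homExt f) y := by
  have hnorm : ∀ x : X, x ≠ 0 → DifferentiableAt ℝ (‖·‖) x := fun x hx => by
    have h1 : ‖unitDir x‖ = 1 := by
      simpa [unitDir, norm_smul] using inv_mul_cancel₀ (norm_ne_zero_iff.2 hx)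
    exact ((hsmooth _ (by simpa using h1)).differentiableAt_norm h1).differentiableAt_norm_of_smul
  intro y hy
  have h1 : unitDir y ∈ sphere (0 : X) 1 := by
    simpa [unitDir, norm_smul] using inv_mul_cancel₀ (norm_ne_zero_iff.2 hy)
  exact (differentiableAt_homExt hy (hnorm y hy)
    (differentiableWithinAt_of_sphere_isometry hnorm hbij hiso h1)).gateauxAt
end
end
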